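/- A point x̂ ∈ X is a minimizer of I (equivalently, x̂ ∈ E_γ and Φ(x̂) ≤ Φ(x) for all x ∈ E_γ) if and only if x̂ is a generalized mode of the posterior measure μ^y. -/

import Mathlib

open MeasureTheory Metric Filter Topology

/-- The space `c₀` of real sequences converging to zero, with the supremum norm,
realized as the zero-at-infinity continuous maps on `ℕ`. -/
abbrev CZero : Type := ZeroAtInftyContinuousMap ℕ ℝ

/-- The set `E_γ = {x : ∀ k, |x_k| ≤ γ_k}`. -/
def Egamma (γ : ℕ → ℝ) : Set CZero := {x | ∀ k, |x k| ≤ γ k}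

/-- The set `E_γ^δ = {x : ∀ k, |x_k| ≤ max (γ_k - δ) 0}`. -/
def EgammaD (γ : ℕ → ℝ) (δ : ℝ) : Set CZero := {x | ∀ k, |x k| ≤ max (γ k - δ) 0}

/-- The law `ν_k` of `γ_k ξ_k` where `ξ_k` is uniform on `[-1,1]`: the uniform distribution
on `[-γ_k, γ_k]` if `γ_k > 0`, and the Dirac measure at `0` if `γ_k = 0`. -/
noncomputable def nuMeas (γ : ℕ → ℝ) (k : ℕ) : Measure ℝ :=
  if γ k = 0 then Measure.dirac 0
  else (ENNReal.ofReal (2 * γ k))⁻¹ • volume.restrict (Set.Icc (-(γ k)) (γ k))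

/-- `μ` is the law on `c₀` of the random series `ξ = Σ γ_k ξ_k e_k` with `ξ_k` i.i.d. uniform
on `[-1,1]` (equivalently, the pushforward under `t ↦ (γ_k t_k)_k` of the countable product of
uniform measures on `[-1,1]`), characterized by its finite-dimensional marginals: the
coordinates are independent with `x_k ∼ ν_k`. -/
def IsUniformSeriesLaw (γ : ℕ → ℝ) {m : MeasurableSpace CZero} (μ : Measure CZero) : Prop :=
  ∀ (n : ℕ) (A : ℕ → Set ℝ), (∀ k, MeasurableSet (A k)) →
    μ {x : CZero | ∀ k < n, x k ∈ A k} = ∏ k ∈ Finset.range n, nuMeas γ k (A k)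

/-- The maximal probability of an open ball of radius `δ` under `μ`. -/
noncomputable def maxBallProb {X : Type*} [PseudoMetricSpace X] [MeasurableSpace X]
    (μ : Measure X) (δ : ℝ) : ℝ :=
  ⨆ x : X, (μ (ball x δ)).toReal

/-- `xhat` is a strong mode of `μ` if `μ(B^δ(xhat))/M^δ → 1` as `δ → 0⁺`. -/
def IsStrongMode {X : Type*} [PseudoMetricSpace X] [MeasurableSpace X]
    (μ : Measure X) (xhat : X) : Prop :=
  Tendsto (fun δ : ℝ => (μ (ball xhat δ)).toReal / maxBallProb μ δ) (𝓝[>] (0 : ℝ)) (𝓝 1)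

/-- `xhat` is a generalized mode of `μ` if for every positive sequence `δ_n → 0` there is an
approximating sequence `w_n → xhat` with `μ(B^{δ_n}(w_n))/M^{δ_n} → 1`. -/
def IsGeneralizedMode {X : Type*} [PseudoMetricSpace X] [MeasurableSpace X]
    (μ : Measure X) (xhat : X) : Prop :=
  ∀ δ : ℕ → ℝ, (∀ n, 0 < δ n) → Tendsto δ atTop (𝓝 (0 : ℝ)) →
    ∃ w : ℕ → X, Tendsto w atTop (𝓝 xhat) ∧
      Tendsto (fun n => (μ (ball (w n) (δ n))).toReal / maxBallProb μ (δ n)) atTop (𝓝 1)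

/-- The normalization constant `Z = ∫ exp(-Φ(x)) dμ(x)`. -/
noncomputable def normConst {m : MeasurableSpace CZero} (μ : Measure CZero)
    (Φ : CZero → ℝ) : ENNReal :=
  ∫⁻ x, ENNReal.ofReal (Real.exp (-Φ x)) ∂μ

/-- The posterior measure `μ^y(A) = Z⁻¹ ∫_A exp(-Φ(x)) dμ(x)`. -/
noncomputable def posterior {m : MeasurableSpace CZero} (μ : Measure CZero)
    (Φ : CZero → ℝ) : Measure CZero :=
  (normConst μ Φ)⁻¹ • μ.withDensity (fun x => ENNReal.ofReal (Real.exp (-Φ x)))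

/-- `Φ` is Lipschitz continuous on every bounded subset of `c₀`. -/
def LipschitzOnBounded (Φ : CZero → ℝ) : Prop :=
  ∀ r : ℝ, 0 < r → ∃ L : ℝ, ∀ x₁ x₂ : CZero, ‖x₁‖ ≤ r → ‖x₂‖ ≤ r →
    |Φ x₁ - Φ x₂| ≤ L * ‖x₁ - x₂‖

lemma nuMeas_ball_le (γ : ℕ → ℝ) {δ : ℝ} (hδ : 0 < δ) (k : ℕ) (t : ℝ) :
    nuMeas γ k (ball t δ) ≤ nuMeas γ k (ball 0 δ) := by
  unfold nuMeas
  split_ifs with h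
  · rw [Measure.dirac_apply_of_mem (mem_ball_self hδ)]
    exact prob_le_one
  · simp only [Measure.smul_apply, smul_eq_mul]
    gcongr 1
    rcases le_or_gt δ (γ k) with hle | hlt
    · rw [Measure.restrict_eq_self _ (s := ball 0 δ)]
      · refine (Measure.restrict_apply_le _ _).trans ?_
        simp [Real.volume_ball]
      · intro y hy
        rw [mem_ball, Real.dist_eq, sub_zero, abs_lt] at hy
        exact ⟨by linarith, by linarith⟩
    · refine (measure_mono (Set.subset_univ _)).trans ?_
      rw [Measure.restrict_apply_univ, Measure.restrict_apply measurableSet_ball]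
      refine measure_mono fun y hy => ⟨?_, hy⟩
      rw [mem_ball, Real.dist_eq, sub_zero, abs_lt]
      exact ⟨by linarith [hy.1], by linarith [hy.2]⟩

lemma nuMeas_ball_zero_le (γ : ℕ → ℝ) {δ : ℝ} (hδ : 0 < δ) (k : ℕ) {t : ℝ}
    (ht : |t| ≤ max (γ k - δ) 0) :
    nuMeas γ k (ball 0 δ) ≤ nuMeas γ k (ball t δ) := by
  rcases le_or_gt δ (γ k) with hle | hlt
  · rw [max_eq_left (by linarith), abs_le] at ht
    unfold nuMeas
    rw [if_neg (by linarith)]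
    simp only [Measure.smul_apply, smul_eq_mul]
    gcongr 1
    rw [Measure.restrict_eq_self _ (s := ball t δ)]
    · refine (Measure.restrict_apply_le _ _).trans ?_
      simp [Real.volume_ball]
    · intro y hy
      rw [mem_ball, Real.dist_eq, abs_lt] at hy
      exact ⟨by linarith, by linarith⟩
  · rw [max_eq_right (by linarith)] at ht
    rw [abs_nonpos_iff.1 ht]

lemma nuMeas_Icc (γ : ℕ → ℝ) (hγ0 : ∀ k, 0 ≤ γ k) (k : ℕ) :
    nuMeas γ k (Set.Icc (-(γ k)) (γ k)) = 1 := by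
  unfold nuMeas
  split_ifs with h
  · simp [h]
  · have : 0 < γ k := lt_of_le_of_ne (hγ0 k) (Ne.symm h)
    rw [Measure.smul_apply, Measure.restrict_apply_self, Real.volume_Icc, smul_eq_mul,
      show γ k - -(γ k) = 2 * γ k by ring]
    exact ENNReal.inv_mul_cancel (by simpa using this) ENNReal.ofReal_ne_top

lemma nuMeas_ball_zero_ne_zero (γ : ℕ → ℝ) (hγ0 : ∀ k, 0 ≤ γ k) {δ : ℝ} (hδ : 0 < δ) (k : ℕ) :
    nuMeas γ k (ball 0 δ) ≠ 0 := by
  unfold nuMeas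
  split_ifs with h
  · rw [Measure.dirac_apply_of_mem (mem_ball_self hδ)]
    exact one_ne_zero
  · have hpos : 0 < γ k := lt_of_le_of_ne (hγ0 k) (Ne.symm h)
    rw [Measure.smul_apply, smul_eq_mul]
    refine mul_ne_zero (ENNReal.inv_ne_zero.2 ENNReal.ofReal_ne_top) ?_
    rw [Measure.restrict_apply measurableSet_ball]
    refine (Measure.measure_pos_of_mem_nhds volume (x := (0 : ℝ)) ?_).ne'
    exact inter_mem (ball_mem_nhds _ hδ) (Icc_mem_nhds (by linarith) hpos)

lemma CZero.continuous_apply (k : ℕ) : Continuous fun x : CZero => x k :=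
  (BoundedContinuousFunction.lipschitz_eval_const k).continuous.comp
    (ZeroAtInftyContinuousMap.isometry_toBCF).continuous

lemma CZero.tendsto_atTop (x : CZero) : Tendsto x atTop (𝓝 0) := by
  have h := zero_at_infty x
  rwa [Filter.cocompact_eq_cofinite, Nat.cofinite_eq_atTop] at h

lemma CZero.dist_le_iff (x y : CZero) {C : ℝ} (hC : 0 ≤ C) :
    dist x y ≤ C ↔ ∀ k, |x k - y k| ≤ C := by
  rw [← ZeroAtInftyContinuousMap.dist_toBCF_eq_dist, BoundedContinuousFunction.dist_le hC]
  rfl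

lemma CZero.mem_ball_iff (x y : CZero) {δ : ℝ} (hδ : 0 < δ) :
    y ∈ ball x δ ↔ ∀ k, y k ∈ ball (x k) δ := by
  simp only [mem_ball, Real.dist_eq]
  refine ⟨fun h k => ((CZero.dist_le_iff y x dist_nonneg).1 le_rfl k).trans_lt h, fun h => ?_⟩
  have htend : Tendsto (fun k => |y k - x k|) atTop (𝓝 0) := by
    simpa using ((CZero.tendsto_atTop y).sub (CZero.tendsto_atTop x)).abs
  obtain ⟨N, hN⟩ := eventually_atTop.1 (htend.eventually_lt_const (half_pos hδ))
  set C := (Finset.range (N + 1)).sup' ⟨0, by simp⟩ fun k => |y k - x k|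
  have hC : C < δ := (Finset.sup'_lt_iff _).2 fun k _ => h k
  refine ((CZero.dist_le_iff y x (C := max C (δ / 2)) (by positivity)).2 fun k => ?_).trans_lt
    (max_lt hC (half_lt_self hδ))
  rcases lt_or_ge k N with hk | hk
  · exact le_max_of_le_left
      (Finset.le_sup' (fun k => |y k - x k|) (Finset.mem_range.2 (by omega)))
  · exact le_max_of_le_right (hN k hk).le

lemma isClosed_Egamma (γ : ℕ → ℝ) : IsClosed (Egamma γ) := by
  simp only [Egamma, Set.ofPred_forall]
  exact isClosed_iInter fun k => isClosed_le (CZero.continuous_apply k).abs continuous_const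

/-- Soft thresholding by `δ` maps `E_γ` to `E_γ^δ` and moves points by at most `δ`. -/
lemma exists_mem_EgammaD {γ : ℕ → ℝ} {x : CZero} (hx : x ∈ Egamma γ) {δ : ℝ} (hδ : 0 < δ) :
    ∃ w ∈ EgammaD γ δ, dist w x ≤ δ := by
  let f : ℕ → ℝ := fun k => x k - max (-δ) (min (x k) δ)
  have hf : ∀ k, |f k| = max (|x k| - δ) 0 := fun k => by
    simp only [f]
    grind
  have hlim : Tendsto f atTop (𝓝 0) := by
    refine squeeze_zero_norm (a := fun k => |x k|) (fun k => ?_) ?_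
    · rw [Real.norm_eq_abs, hf]
      exact max_le (by linarith) (abs_nonneg _)
    · simpa using (CZero.tendsto_atTop x).abs
  refine ⟨⟨⟨f, continuous_of_discreteTopology⟩, ?_⟩, fun k => ?_, ?_⟩
  · rwa [Filter.cocompact_eq_cofinite, Nat.cofinite_eq_atTop]
  · change |f k| ≤ _
    rw [hf]
    exact max_le_max_right _ (by linarith [hx k])
  · refine (CZero.dist_le_iff _ _ hδ.le).2 fun k => ?_
    change |f k - x k| ≤ δ
    simp only [f]
    grind

lemma LipschitzOnBounded.continuous {Φ : CZero → ℝ} (hΦ : LipschitzOnBounded Φ) :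
    Continuous Φ := by
  refine continuous_iff_continuousAt.2 fun x => ?_
  obtain ⟨L, hL⟩ := hΦ (‖x‖ + 1) (by positivity)
  refine tendsto_iff_norm_sub_tendsto_zero.2 ?_
  have hlim : Tendsto (fun y => L * ‖y - x‖) (𝓝 x) (𝓝 0) := by
    have : Continuous fun y : CZero => L * ‖y - x‖ := by fun_prop
    simpa using this.tendsto x
  refine squeeze_zero' (Eventually.of_forall fun _ => norm_nonneg _) ?_ hlim
  filter_upwards [ball_mem_nhds x one_pos] with y hy
  refine hL y x ?_ (by linarith)
  have := norm_le_norm_add_norm_sub' y x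
  rw [mem_ball, dist_eq_norm] at hy
  linarith

lemma isProbabilityMeasure_posterior [MeasurableSpace CZero] {μ : Measure CZero} {Φ : CZero → ℝ}
    (hZ0 : normConst μ Φ ≠ 0) (hZtop : normConst μ Φ ≠ ⊤) :
    IsProbabilityMeasure (posterior μ Φ) := by
  refine ⟨?_⟩
  rw [posterior, Measure.smul_apply, smul_eq_mul, withDensity_apply _ .univ,
    Measure.restrict_univ]
  exact ENNReal.inv_mul_cancel hZ0 hZtop

section Law

variable {γ : ℕ → ℝ} [MeasurableSpace CZero] [BorelSpace CZero] {μ : Measure CZero}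

lemma IsUniformSeriesLaw.ae_mem_Egamma [IsProbabilityMeasure μ] (hμ : IsUniformSeriesLaw γ μ)
    (hγ0 : ∀ k, 0 ≤ γ k) : ∀ᵐ x ∂μ, x ∈ Egamma γ := by
  refine ae_all_iff.2 fun n => ?_
  have h := hμ (n + 1) (fun k => Set.Icc (-(γ k)) (γ k)) fun k => measurableSet_Icc
  simp only [nuMeas_Icc γ hγ0, Finset.prod_const_one] at h
  have hm : MeasurableSet {x : CZero | ∀ k < n + 1, x k ∈ Set.Icc (-(γ k)) (γ k)} := by
    simp only [Set.ofPred_forall]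
    exact .iInter fun k => .iInter fun _ =>
      (CZero.continuous_apply k).measurable measurableSet_Icc
  filter_upwards [(mem_ae_iff_prob_eq_one hm).2 h] with x hx
  exact abs_le.2 (hx n n.lt_succ_self)

/-- Comparing all one-dimensional marginals of two balls compares the balls. -/
lemma IsUniformSeriesLaw.measure_ball_mono [IsProbabilityMeasure μ]
    (hμ : IsUniformSeriesLaw γ μ) {x y : CZero} {δ : ℝ} (hδ : 0 < δ)
    (h : ∀ k, nuMeas γ k (ball (x k) δ) ≤ nuMeas γ k (ball (y k) δ)) :
    μ (ball x δ) ≤ μ (ball y δ) := by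
  have hm (n : ℕ) : MeasurableSet {z : CZero | ∀ k < n, z k ∈ ball (y k) δ} := by
    simp only [Set.ofPred_forall]
    exact .iInter fun k => .iInter fun _ =>
      (CZero.continuous_apply k).measurable measurableSet_ball
  have hball : ball y δ = ⋂ n, {z : CZero | ∀ k < n, z k ∈ ball (y k) δ} := by
    ext z
    simp only [CZero.mem_ball_iff y z hδ, Set.mem_iInter, Set.mem_ofPred_eq]
    exact ⟨fun h n k _ => h k, fun h k => h (k + 1) k k.lt_succ_self⟩
  have hanti : Antitone fun n => {z : CZero | ∀ k < n, z k ∈ ball (y k) δ} :=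
    fun m n hmn z hz k hk => hz k (hk.trans_le hmn)
  rw [hball, hanti.measure_iInter (fun n => (hm n).nullMeasurableSet) ⟨0, measure_ne_top _ _⟩]
  refine le_iInf fun n => ?_
  calc μ (ball x δ) ≤ μ {z : CZero | ∀ k < n, z k ∈ ball (x k) δ} :=
        measure_mono fun z hz k _ => (CZero.mem_ball_iff x z hδ).1 hz k
    _ = ∏ k ∈ Finset.range n, nuMeas γ k (ball (x k) δ) := hμ n _ fun _ => measurableSet_ball
    _ ≤ ∏ k ∈ Finset.range n, nuMeas γ k (ball (y k) δ) := Finset.prod_le_prod' fun k _ => h k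
    _ = _ := (hμ n _ fun _ => measurableSet_ball).symm

lemma IsUniformSeriesLaw.measure_ball_zero_ne_zero [IsProbabilityMeasure μ]
    (hμ : IsUniformSeriesLaw γ μ) (hγ0 : ∀ k, 0 ≤ γ k) (hγ : Tendsto γ atTop (𝓝 0)) {δ : ℝ}
    (hδ : 0 < δ) : μ (ball 0 δ) ≠ 0 := by
  obtain ⟨N, hN⟩ := eventually_atTop.1 (hγ.eventually_lt_const hδ)
  have hcyl := hμ N (fun _ => ball 0 δ) fun _ => measurableSet_ball
  have hne : μ {x : CZero | ∀ k < N, x k ∈ ball (0 : ℝ) δ} ≠ 0 := by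
    rw [hcyl]
    exact Finset.prod_ne_zero_iff.2 fun k _ => nuMeas_ball_zero_ne_zero γ hγ0 hδ k
  refine fun h0 => hne (le_antisymm (h0 ▸ measure_mono_ae ?_) zero_le)
  filter_upwards [hμ.ae_mem_Egamma hγ0] with x hx hxN
  refine (CZero.mem_ball_iff 0 x hδ).2 fun k => ?_
  rcases lt_or_ge k N with hk | hk
  · exact hxN k hk
  · rw [mem_ball, Real.dist_eq]
    simpa using (hx k).trans_lt (hN k hk)

lemma posterior_ball_le [IsProbabilityMeasure μ] (hμ : IsUniformSeriesLaw γ μ)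
    (hγ0 : ∀ k, 0 ≤ γ k) {Φ : CZero → ℝ} {x : CZero} {δ a : ℝ} (hδ : 0 < δ)
    (h : ∀ y ∈ ball x δ, y ∈ Egamma γ → a ≤ Φ y) :
    posterior μ Φ (ball x δ) ≤
      (normConst μ Φ)⁻¹ * (ENNReal.ofReal (Real.exp (-a)) * μ (ball 0 δ)) := by
  rw [posterior, Measure.smul_apply, smul_eq_mul, withDensity_apply _ measurableSet_ball]
  gcongr
  calc ∫⁻ y in ball x δ, ENNReal.ofReal (Real.exp (-Φ y)) ∂μ
      ≤ ∫⁻ _ in ball x δ, ENNReal.ofReal (Real.exp (-a)) ∂μ := by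
        refine setLIntegral_mono_ae' measurableSet_ball ?_
        filter_upwards [hμ.ae_mem_Egamma hγ0] with y hyE hy
        have := h y hy hyE
        gcongr
    _ = ENNReal.ofReal (Real.exp (-a)) * μ (ball x δ) := setLIntegral_const _ _
    _ ≤ _ := by
        gcongr 1
        exact hμ.measure_ball_mono hδ fun k => nuMeas_ball_le γ hδ k _

lemma le_posterior_ball [IsProbabilityMeasure μ] (hμ : IsUniformSeriesLaw γ μ)
    {Φ : CZero → ℝ} {x : CZero} {δ a : ℝ} (hδ : 0 < δ)
    (hx : x ∈ EgammaD γ δ) (h : ∀ y ∈ ball x δ, Φ y ≤ a) :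
    (normConst μ Φ)⁻¹ * (ENNReal.ofReal (Real.exp (-a)) * μ (ball 0 δ)) ≤
      posterior μ Φ (ball x δ) := by
  rw [posterior, Measure.smul_apply, smul_eq_mul, withDensity_apply _ measurableSet_ball]
  gcongr
  calc ENNReal.ofReal (Real.exp (-a)) * μ (ball 0 δ)
      ≤ ENNReal.ofReal (Real.exp (-a)) * μ (ball x δ) := by
        gcongr 1
        exact hμ.measure_ball_mono hδ fun k => nuMeas_ball_zero_le γ hδ k (hx k)
    _ = ∫⁻ _ in ball x δ, ENNReal.ofReal (Real.exp (-a)) ∂μ := (setLIntegral_const _ _).symm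
    _ ≤ _ := by
        refine setLIntegral_mono' measurableSet_ball fun y hy => ?_
        have := h y hy
        gcongr

end Law

lemma le_maxBallProb {X : Type*} [PseudoMetricSpace X] [MeasurableSpace X] (μ : Measure X)
    [IsProbabilityMeasure μ] (x : X) (δ : ℝ) : (μ (ball x δ)).toReal ≤ maxBallProb μ δ :=
  le_ciSup (f := fun x => (μ (ball x δ)).toReal)
    ⟨1, Set.forall_mem_range.2 fun _ => measureReal_le_one⟩ x

theorem minimizer_iff_generalizedMAP (γ : ℕ → ℝ) (hγ0 : ∀ k, 0 ≤ γ k)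
    (hγ : Tendsto γ atTop (𝓝 (0 : ℝ)))
    [MeasurableSpace CZero] [BorelSpace CZero]
    (μ : Measure CZero) [IsProbabilityMeasure μ] (hμ : IsUniformSeriesLaw γ μ)
    (Φ : CZero → ℝ) (hΦ : LipschitzOnBounded Φ)
    (hZ0 : normConst μ Φ ≠ 0) (hZtop : normConst μ Φ ≠ ⊤)
    (xhat : CZero) :
    (xhat ∈ Egamma γ ∧ ∀ z ∈ Egamma γ, Φ xhat ≤ Φ z) ↔
      IsGeneralizedMode (posterior μ Φ) xhat := by
  have hprob := isProbabilityMeasure_posterior hZ0 hZtop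
  let c : ℝ → ℝ := fun δ => ((normConst μ Φ)⁻¹ * μ (ball 0 δ)).toReal
  have hfin (δ : ℝ) : (normConst μ Φ)⁻¹ * μ (ball 0 δ) ≠ ⊤ :=
    ENNReal.mul_ne_top (ENNReal.inv_ne_top.2 hZ0) (measure_ne_top _ _)
  have hc {δ : ℝ} (hδ : 0 < δ) : 0 < c δ :=
    ENNReal.toReal_pos (mul_ne_zero (ENNReal.inv_ne_zero.2 hZtop)
      (hμ.measure_ball_zero_ne_zero hγ0 hγ hδ)) (hfin δ)
  have hreal (a δ : ℝ) : (normConst μ Φ)⁻¹ * (ENNReal.ofReal (Real.exp (-a)) * μ (ball 0 δ)) =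
      ENNReal.ofReal (Real.exp (-a) * c δ) := by
    rw [ENNReal.ofReal_mul (Real.exp_pos _).le, ENNReal.ofReal_toReal (hfin δ)]
    ring
  have hupper {x : CZero} {δ a : ℝ} (hδ : 0 < δ)
      (h : ∀ y ∈ ball x δ, y ∈ Egamma γ → a ≤ Φ y) :
      (posterior μ Φ (ball x δ)).toReal ≤ Real.exp (-a) * c δ := by
    refine ENNReal.toReal_le_of_le_ofReal (mul_nonneg (Real.exp_pos _).le (hc hδ).le) ?_
    rw [← hreal]
    exact posterior_ball_le hμ hγ0 hδ h
  have hlower {x : CZero} {δ a : ℝ} (hδ : 0 < δ) (hx : x ∈ EgammaD γ δ)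
      (h : ∀ y ∈ ball x δ, Φ y ≤ a) :
      Real.exp (-a) * c δ ≤ (posterior μ Φ (ball x δ)).toReal := by
    rw [← ENNReal.ofReal_le_iff_le_toReal (measure_ne_top _ _), ← hreal]
    exact le_posterior_ball hμ hδ hx h
  have hcont := hΦ.continuous
  have hM {z : CZero} (hz : z ∈ Egamma γ) {δ a : ℝ} (hδ : 0 < δ)
      (h : ∀ y ∈ ball z (2 * δ), Φ y ≤ a) :
      Real.exp (-a) * c δ ≤ maxBallProb (posterior μ Φ) δ := by
    obtain ⟨w, hw, hwz⟩ := exists_mem_EgammaD hz hδ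
    exact (hlower hδ hw fun y hy => h y (ball_subset_ball' (by linarith) hy)).trans
      (le_maxBallProb _ _ _)
  constructor
  · rintro ⟨hx, hmin⟩ δ hδ hδ0
    choose w hw hwx using fun n => exists_mem_EgammaD hx (hδ n)
    refine ⟨w, tendsto_iff_dist_tendsto_zero.2
      (squeeze_zero (fun _ => dist_nonneg) hwx hδ0), ?_⟩
    have hle (n : ℕ) : maxBallProb (posterior μ Φ) (δ n) ≤ Real.exp (-Φ xhat) * c (δ n) :=
      ciSup_le fun x => hupper (hδ n) fun y _ hy => hmin y hy
    have hlim : Tendsto (fun ε : ℝ => Real.exp (-ε)) (𝓝 0) (𝓝 1) := by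
      have : Continuous fun ε : ℝ => Real.exp (-ε) := by fun_prop
      simpa using this.tendsto 0
    refine tendsto_order.2 ⟨fun b hb => ?_, fun b hb => Eventually.of_forall fun n =>
      (div_le_one_of_le₀ (le_maxBallProb _ _ _)
        (ENNReal.toReal_nonneg.trans (le_maxBallProb _ (w n) _))).trans_lt hb⟩
    obtain ⟨ε, hbε, hε⟩ := (((hlim.mono_left nhdsWithin_le_nhds).eventually_const_lt hb).and
      (self_mem_nhdsWithin (s := Set.Ioi (0 : ℝ)))).exists
    obtain ⟨r, hr, hball⟩ := Metric.eventually_nhds_iff_ball.1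
      (hcont.continuousAt.eventually_lt_const (lt_add_of_pos_right (Φ xhat) hε))
    filter_upwards [hδ0.eventually_lt_const (half_pos hr)] with n hn
    have hlow : Real.exp (-(Φ xhat + ε)) * c (δ n) ≤ (posterior μ Φ (ball (w n) (δ n))).toReal :=
      hlower (hδ n) (hw n) fun y hy =>
        (hball y (ball_subset_ball' (by linarith [hwx n]) hy)).le
    have hMpos : 0 < maxBallProb (posterior μ Φ) (δ n) :=
      (mul_pos (Real.exp_pos _) (hc (hδ n))).trans_le (hlow.trans (le_maxBallProb _ _ _))
    refine hbε.trans_le ((le_div_iff₀ hMpos).2 ?_)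
    calc Real.exp (-ε) * maxBallProb (posterior μ Φ) (δ n)
        ≤ Real.exp (-ε) * (Real.exp (-Φ xhat) * c (δ n)) := by gcongr; exact hle n
      _ = Real.exp (-(Φ xhat + ε)) * c (δ n) := by rw [neg_add, Real.exp_add]; ring
      _ ≤ _ := hlow
  · intro hmode
    obtain ⟨δ, hδ, hδ0⟩ : ∃ δ : ℕ → ℝ, (∀ n, 0 < δ n) ∧ Tendsto δ atTop (𝓝 0) :=
      ⟨_, fun _ => Nat.one_div_pos_of_nat, tendsto_one_div_add_atTop_nhds_zero_nat⟩
    obtain ⟨w, hw, hratio⟩ := hmode δ hδ hδ0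
    have hnhds {z : CZero} (hz : z ∈ Egamma γ) {a : ℝ} (ha : Φ z < a) :
        ¬ ∀ᶠ y in 𝓝 xhat, y ∈ Egamma γ → a ≤ Φ y := by
      intro hev
      obtain ⟨b, hzb, hba⟩ := exists_between ha
      obtain ⟨r, hr, hball⟩ := Metric.eventually_nhds_iff_ball.1 hev
      obtain ⟨s, hs, hball'⟩ := Metric.eventually_nhds_iff_ball.1
        (hcont.continuousAt.eventually_lt_const hzb)
      have hlt : Real.exp (b - a) < 1 := Real.exp_lt_one_iff.2 (by linarith)
      obtain ⟨n, hn, hns, hnr, hnw⟩ := ((hratio.eventually_const_lt hlt).and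
        ((hδ0.eventually_lt_const (half_pos hs)).and
          ((hδ0.eventually_lt_const (half_pos hr)).and
            ((tendsto_iff_dist_tendsto_zero.1 hw).eventually_lt_const (half_pos hr))))).exists
      have hup : (posterior μ Φ (ball (w n) (δ n))).toReal ≤ Real.exp (-a) * c (δ n) :=
        hupper (hδ n) fun y hy =>
          hball y (ball_subset_ball' (by linarith) hy)
      have hlow : Real.exp (-b) * c (δ n) ≤ maxBallProb (posterior μ Φ) (δ n) :=
        hM hz (hδ n) fun y hy => (hball' y (ball_subset_ball (by linarith) hy)).le
      have hMpos : 0 < maxBallProb (posterior μ Φ) (δ n) :=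
        (mul_pos (Real.exp_pos _) (hc (hδ n))).trans_le hlow
      refine hn.not_ge ((div_le_iff₀ hMpos).2 (hup.trans ?_))
      calc Real.exp (-a) * c (δ n) = Real.exp (b - a) * (Real.exp (-b) * c (δ n)) := by
            rw [← mul_assoc, ← Real.exp_add]; ring_nf
        _ ≤ _ := by gcongr
    refine ⟨?_, fun z hz => ?_⟩
    · by_contra hx
      have h0 : (0 : CZero) ∈ Egamma γ := fun k => by simpa using hγ0 k
      refine hnhds h0 (lt_add_one (Φ 0)) ?_
      filter_upwards [(isClosed_Egamma γ).isOpen_compl.mem_nhds hx] with y hy hyE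
      exact absurd hyE hy
    · by_contra! hlt
      obtain ⟨a, hza, hax⟩ := exists_between hlt
      refine hnhds hz hza ?_
      filter_upwards [hcont.continuousAt.eventually_const_lt hax] with y hy _
      exact hy.le
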